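/- Let p ≥ 1, let P be a p×p real orthogonal matrix, let D = diag(σ₁, …, σ_p) with all σₖ > 0, and let M be a p×p real symmetric positive definite matrix whose smallest and largest eigenvalues λ_min, λ_max satisfy 0 < λ_min ≤ 1 ≤ λ_max. Set Σ = PᵀD²P, Σ̂ = PᵀD M D P, S_Σ = Σ⁻¹𝟙, S_Σ̂ = Σ̂⁻¹𝟙, where 𝟙 ∈ ℝᵖ is the all-ones vector. Then ‖S_Σ − S_Σ̂‖₂ ≤ ‖S_Σ‖₂ · (σ_max / σ_min) · (λ_min⁻¹ − λ_max⁻¹), with σ_max = maxₖ σₖ, σ_min = minₖ σₖ. -/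

import Mathlib

open Matrix

/-- The Euclidean (ℓ²) norm of a vector in `ℝᵖ`. -/
noncomputable def euclideanNorm {p : ℕ} (x : Fin p → ℝ) : ℝ :=
  ‖(WithLp.equiv 2 (Fin p → ℝ)).symm x‖

open scoped Matrix.Norms.L2Operator in
theorem Matrix.l2_opNorm_le_one_of_transpose_mul_self {n : Type*} [Fintype n] [DecidableEq n]
    {A : Matrix n n ℝ} (hA : Aᵀ * A = 1) : ‖A‖ ≤ 1 := by
  have h := Matrix.l2_opNorm_conjTranspose_mul_self A
  rw [conjTranspose_eq_transpose_of_trivial, hA, ← diagonal_one, l2_opNorm_diagonal] at h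
  have h1 : ‖(fun _ => 1 : n → ℝ)‖ ≤ 1 := (pi_norm_le_iff_of_nonneg zero_le_one).2 (by simp)
  nlinarith [norm_nonneg A]

open scoped Matrix.Norms.L2Operator in
theorem Matrix.l2_opNorm_diagonal_le {n : Type*} [Fintype n] [DecidableEq n]
    {d : n → ℝ} {c : ℝ} (hc : 0 ≤ c) (h : ∀ i, |d i| ≤ c) : ‖diagonal d‖ ≤ c := by
  rw [l2_opNorm_diagonal]
  exact (pi_norm_le_iff_of_nonneg hc).2 h

open scoped Matrix.Norms.L2Operator in
theorem Matrix.PosDef.l2_opNorm_one_sub_inv_le {n : Type*} [Fintype n] [DecidableEq n]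
    {M : Matrix n n ℝ} (hM : M.PosDef) {c : ℝ} (hc : 0 ≤ c)
    (h : ∀ x ∈ spectrum ℝ M, |1 - x⁻¹| ≤ c) : ‖1 - M⁻¹‖ ≤ c := by
  have hH := hM.isHermitian
  obtain ⟨U, hU⟩ : ∃ U : Matrix n n ℝ, U = hH.eigenvectorUnitary := ⟨_, rfl⟩
  have hUt : Uᵀ * U = 1 := by
    rw [← conjTranspose_eq_transpose_of_trivial, hU]
    exact Unitary.coe_star_mul_self hH.eigenvectorUnitary
  have hUt' : U * Uᵀ = 1 := mul_eq_one_comm.1 hUt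
  have hMU : M = U * diagonal hH.eigenvalues * Uᵀ := by
    conv_lhs => rw [hH.spectral_theorem]
    rw [hU, ← conjTranspose_eq_transpose_of_trivial]
    rfl
  have hinv : M⁻¹ = U * diagonal (fun i => (hH.eigenvalues i)⁻¹) * Uᵀ := by
    apply inv_eq_right_inv
    have hd : diagonal hH.eigenvalues * diagonal (fun i => (hH.eigenvalues i)⁻¹) = 1 := by
      rw [diagonal_mul_diagonal, ← diagonal_one]
      congr 1
      ext i
      exact mul_inv_cancel₀ (hM.eigenvalues_pos i).ne'
    calc M * (U * diagonal (fun i => (hH.eigenvalues i)⁻¹) * Uᵀ)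
        = U * diagonal hH.eigenvalues * (Uᵀ * U) *
            diagonal (fun i => (hH.eigenvalues i)⁻¹) * Uᵀ := by
          conv_lhs => enter [1]; rw [hMU]
          simp only [Matrix.mul_assoc]
      _ = U * (diagonal hH.eigenvalues * diagonal (fun i => (hH.eigenvalues i)⁻¹)) * Uᵀ := by
          rw [hUt, Matrix.mul_one]; simp only [Matrix.mul_assoc]
      _ = 1 := by rw [hd, Matrix.mul_one, hUt']
  have hsub : 1 - M⁻¹ = U * diagonal (fun i => 1 - (hH.eigenvalues i)⁻¹) * Uᵀ := by
    rw [hinv, ← diagonal_sub (fun _ => 1), diagonal_one, Matrix.mul_sub, Matrix.sub_mul,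
      Matrix.mul_one, hUt']
  have h1 := l2_opNorm_le_one_of_transpose_mul_self hUt
  have h2 : ‖Uᵀ‖ ≤ 1 := l2_opNorm_le_one_of_transpose_mul_self (by rwa [transpose_transpose])
  have h3 : ‖diagonal (fun i => 1 - (hH.eigenvalues i)⁻¹)‖ ≤ c :=
    l2_opNorm_diagonal_le hc fun i => h _ (hH.eigenvalues_mem_spectrum_real i)
  rw [hsub]
  calc _ ≤ ‖U‖ * ‖diagonal (fun i => 1 - (hH.eigenvalues i)⁻¹)‖ * ‖Uᵀ‖ :=
        (norm_mul_le _ _).trans (by gcongr; exact norm_mul_le _ _)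
    _ ≤ 1 * c * 1 := by gcongr
    _ = c := by ring

open scoped Matrix.Norms.L2Operator in
theorem euclideanNorm_mulVec_le {p : ℕ} {A : Matrix (Fin p) (Fin p) ℝ} {c : ℝ}
    (hA : ‖A‖ ≤ c) (x : Fin p → ℝ) : euclideanNorm (A *ᵥ x) ≤ c * euclideanNorm x :=
  (Matrix.l2_opNorm_mulVec A (WithLp.toLp 2 x)).trans
    (mul_le_mul_of_nonneg_right hA (norm_nonneg _))

theorem Matrix.sub_inv_congr_mulVec {n R : Type*} [Fintype n] [DecidableEq n] [CommRing R]
    {P D M : Matrix n n R} (hP : Pᵀ * P = 1) (hD : IsUnit D) (x : n → R) :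
    (Pᵀ * D ^ 2 * P)⁻¹ *ᵥ x - (Pᵀ * D * M * D * P)⁻¹ *ᵥ x =
      (Pᵀ * D⁻¹ * (1 - M⁻¹) * (D * P)) *ᵥ ((Pᵀ * D ^ 2 * P)⁻¹ *ᵥ x) := by
  have hPi : P⁻¹ = Pᵀ := inv_eq_left_inv hP
  have hPti : (Pᵀ)⁻¹ = P := inv_eq_right_inv hP
  have hP' : P * Pᵀ = 1 := mul_eq_one_comm.1 hP
  have hDi : D * D⁻¹ = 1 := mul_nonsing_inv D ((isUnit_iff_isUnit_det D).1 hD)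
  have hcancel : D * P * (Pᵀ * (D⁻¹ * (D⁻¹ * P))) = D⁻¹ * P := by
    calc _ = D * (P * Pᵀ) * D⁻¹ * (D⁻¹ * P) := by simp only [Matrix.mul_assoc]
      _ = _ := by rw [hP', Matrix.mul_one, hDi, Matrix.one_mul]
  rw [← sub_mulVec, mulVec_mulVec]
  congr 1
  simp only [pow_two, mul_inv_rev, hPi, hPti, Matrix.mul_assoc]
  rw [← Matrix.mul_assoc D P, hcancel]
  simp only [Matrix.mul_sub, Matrix.sub_mul, Matrix.one_mul]

open scoped Matrix.Norms.L2Operator in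
theorem free_weight_error_bound_spectral (p : ℕ) (hp : 1 ≤ p)
    (P : Matrix (Fin p) (Fin p) ℝ) (hP : Pᵀ * P = 1)
    (σ : Fin p → ℝ) (hσ : ∀ k, 0 < σ k)
    (D : Matrix (Fin p) (Fin p) ℝ) (hD : D = Matrix.diagonal σ)
    (M : Matrix (Fin p) (Fin p) ℝ) (hM : M.PosDef)
    (lmin lmax : ℝ)
    (hlmin : IsLeast (spectrum ℝ M) lmin) (hlmax : IsGreatest (spectrum ℝ M) lmax)
    (h0 : 0 < lmin) (h1 : lmin ≤ 1) (h2 : 1 ≤ lmax)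
    (Cov CovHat : Matrix (Fin p) (Fin p) ℝ)
    (hCov : Cov = Pᵀ * D ^ 2 * P) (hCovHat : CovHat = Pᵀ * D * M * D * P)
    (SCov SCovHat : Fin p → ℝ)
    (hS : SCov = Cov⁻¹ *ᵥ (1 : Fin p → ℝ))
    (hShat : SCovHat = CovHat⁻¹ *ᵥ (1 : Fin p → ℝ))
    (σmax σmin : ℝ)
    (hσmax : IsGreatest (Set.range σ) σmax) (hσmin : IsLeast (Set.range σ) σmin) :
    euclideanNorm (SCov - SCovHat) ≤
      euclideanNorm SCov * (σmax / σmin) * (lmin⁻¹ - lmax⁻¹) := by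
  subst hD hCov hCovHat hS hShat
  obtain ⟨k, rfl⟩ := hσmin.1
  have hmin := hσ k
  have hmax : 0 ≤ σmax := hmin.le.trans (hσmax.2 ⟨k, rfl⟩)
  have hDu : IsUnit (diagonal σ) :=
    isUnit_diagonal.2 (Pi.isUnit_iff.2 fun i => (hσ i).ne'.isUnit)
  have hDinv : (diagonal σ)⁻¹ = diagonal fun i => (σ i)⁻¹ := by
    apply inv_eq_right_inv
    rw [diagonal_mul_diagonal, ← diagonal_one]
    congr 1
    ext i
    exact mul_inv_cancel₀ (hσ i).ne'
  have hle1 : 1 ≤ lmin⁻¹ := (one_le_inv₀ h0).2 h1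
  have hle2 : lmax⁻¹ ≤ 1 := inv_le_one_of_one_le₀ h2
  have hM' := hM.l2_opNorm_one_sub_inv_le (c := lmin⁻¹ - lmax⁻¹) (by linarith) fun x hx => by
    have hlx : lmin ≤ x := hlmin.2 hx
    have hxl : x ≤ lmax := hlmax.2 hx
    have ha : x⁻¹ ≤ lmin⁻¹ := inv_anti₀ h0 hlx
    have hb : lmax⁻¹ ≤ x⁻¹ := inv_anti₀ (h0.trans_le hlx) hxl
    rw [abs_le]
    constructor <;> linarith
  have hPn := l2_opNorm_le_one_of_transpose_mul_self hP
  have hPtn : ‖Pᵀ‖ ≤ 1 := l2_opNorm_le_one_of_transpose_mul_self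
    (by rw [transpose_transpose]; exact mul_eq_one_comm.1 hP)
  have hDn : ‖diagonal σ‖ ≤ σmax := l2_opNorm_diagonal_le hmax fun i => by
    rw [abs_of_pos (hσ i)]
    exact hσmax.2 ⟨i, rfl⟩
  have hDin : ‖(diagonal σ)⁻¹‖ ≤ (σ k)⁻¹ := by
    rw [hDinv]
    refine l2_opNorm_diagonal_le (inv_nonneg.2 hmin.le) fun i => ?_
    rw [abs_of_pos (inv_pos.2 (hσ i))]
    exact inv_anti₀ hmin (hσmin.2 ⟨i, rfl⟩)
  rw [sub_inv_congr_mulVec hP hDu]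
  refine (euclideanNorm_mulVec_le
    (c := 1 * (σ k)⁻¹ * (lmin⁻¹ - lmax⁻¹) * (σmax * 1)) ?_ _).trans_eq (by ring)
  have hl : 0 ≤ lmin⁻¹ - lmax⁻¹ := by linarith
  exact norm_mul_le_of_le
    (norm_mul_le_of_le (norm_mul_le_of_le hPtn hDin) hM') (norm_mul_le_of_le hDn hPn)
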